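/- For every real homogeneous polynomial P of degree d in variables x, y, z, there exist linear forms L_1, ..., L_d and a homogeneous polynomial R of degree d-2 such that P = L_1·L_2···L_d + (x² + y² + z²)·R (allowing the product of linear forms to be zero). -/

import Mathlib

open MvPolynomial

namespace MvPolynomial

variable {σ R : Type*} [CommSemiring R]

theorem IsHomogeneous.aeval_mul_left {S : Type*} [CommSemiring S] [Algebra R S]
    {P : MvPolynomial σ R} {n : ℕ} (hP : P.IsHomogeneous n) (c : S) (p : σ → S) :
    MvPolynomial.aeval (fun i => c * p i) P = c ^ n * MvPolynomial.aeval p P := by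
  simp only [aeval_def, eval₂_eq, Finset.mul_sum]
  refine Finset.sum_congr rfl fun m hm => ?_
  have hdeg : ∑ i ∈ m.support, m i = n := by
    rw [← Finsupp.degree_apply, Finsupp.degree_eq_weight_one]
    exact hP (mem_support_iff.mp hm)
  simp only [mul_pow, Finset.prod_mul_distrib, Finset.prod_pow_eq_pow_sum, hdeg]
  ring

theorem IsHomogeneous.homogeneousComponent_mul {A : MvPolynomial σ R} {k n : ℕ}
    (hA : A.IsHomogeneous k) (hkn : k ≤ n) (B : MvPolynomial σ R) :
    homogeneousComponent n (A * B) = A * homogeneousComponent (n - k) B := by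
  let _ : GradedAlgebra (homogeneousSubmodule σ R) := gradedAlgebra
  have h := DirectSum.coe_decompose_mul_of_left_mem_of_le (homogeneousSubmodule σ R)
    (a := A) (b := B) hA hkn
  exact (decomposition.decompose'_apply (A * B) n).symm.trans
    (h.trans (congrArg (A * ·) (decomposition.decompose'_apply B (n - k))))

end MvPolynomial

/-- Every real form of positive degree in three variables has a zero on the complex conic
`x² + y² + z² = 0`. -/
theorem exists_aeval_eq_zero_on_conic {d : ℕ} (hd : d ≠ 0) {P : MvPolynomial (Fin 3) ℝ}
    (hP : P.IsHomogeneous d) :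
    ∃ p : Fin 3 → ℂ, p ≠ 0 ∧ p 0 ^ 2 + p 1 ^ 2 + p 2 ^ 2 = 0 ∧ aeval p P = 0 := by
  let f : Fin 3 → Polynomial ℂ :=
    ![.X ^ 2 - 1, .C (-Complex.I) * (.X ^ 2 + 1), .C 2 * .X]
  let g : Fin 3 → Polynomial ℂ :=
    ![1 - .X ^ 2, .C (-Complex.I) * (1 + .X ^ 2), .C 2 * .X]
  have eval_aeval (h : Fin 3 → Polynomial ℂ) (s : ℂ) :
      (aeval h P).eval s = aeval (fun i => (h i).eval s) P := by
    simpa using comp_aeval_apply h ((Polynomial.aeval s).restrictScalars ℝ) P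
  have hI : Complex.I ^ 2 = -1 := Complex.I_sq
  by_cases hF : (aeval f P).degree = 0
  · by_cases hG : (aeval g P).degree = 0
    · exfalso
      have hFG₁ : (aeval f P).eval 1 = (aeval g P).eval 1 := by
        rw [eval_aeval, eval_aeval]
        congr 2
        funext i
        fin_cases i <;> simp [f, g]
      have hFG₂ : (aeval f P).eval 2 = 4 ^ d * (aeval g P).eval (1 / 2) := by
        rw [eval_aeval, eval_aeval, ← hP.aeval_mul_left]
        congr 2
        funext i
        fin_cases i <;> simp [f, g] <;> ring
      have hF0 : (aeval f P).coeff 0 ≠ 0 := fun h => by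
        rw [Polynomial.eq_C_of_degree_eq_zero hF, h] at hF
        simp at hF
      rw [Polynomial.eq_C_of_degree_eq_zero hF, Polynomial.eq_C_of_degree_eq_zero hG,
        Polynomial.eval_C, Polynomial.eval_C] at hFG₁ hFG₂
      rw [← hFG₁] at hFG₂
      have h4 : (4 : ℂ) ^ d = 1 := by
        apply mul_right_cancel₀ hF0
        rw [← hFG₂, one_mul]
      have h4' : (4 : ℕ) ^ d = 1 := by exact_mod_cast h4
      simp [hd] at h4'
    · obtain ⟨t, ht⟩ := IsAlgClosed.exists_root _ hG
      refine ⟨fun i => (g i).eval t, fun h => ?_, ?_, by rw [← eval_aeval]; exact ht⟩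
      · have h0 := congrFun h 0
        have h2 := congrFun h 2
        simp [g] at h0 h2
        simp [h2] at h0
      · simp [g]
        linear_combination (1 + t ^ 2) ^ 2 * hI
  · obtain ⟨t, ht⟩ := IsAlgClosed.exists_root _ hF
    refine ⟨fun i => (f i).eval t, fun h => ?_, ?_, by rw [← eval_aeval]; exact ht⟩
    · have h0 := congrFun h 0
      have h2 := congrFun h 2
      simp [f] at h0 h2
      simp [h2] at h0
    · simp [f]
      linear_combination (1 + t ^ 2) ^ 2 * hI

/-- If a real polynomial vanishes on the complex line through a nonzero point `u + i v` of the conic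
`x² + y² + z² = 0`, then it lies in the ideal generated by `x² + y² + z²` and the linear form
with coefficients `u × v`. -/
theorem exists_linear_mem_span_of_aeval_eq_zero {p : Fin 3 → ℂ} (hp : p ≠ 0)
    (hq : p 0 ^ 2 + p 1 ^ 2 + p 2 ^ 2 = 0) :
    ∃ W : MvPolynomial (Fin 3) ℝ, W.IsHomogeneous 1 ∧
      ∀ P : MvPolynomial (Fin 3) ℝ, (∀ c : ℂ, aeval (fun i => c * p i) P = 0) →
        P ∈ Ideal.span {W, X (0 : Fin 3) ^ 2 + X 1 ^ 2 + X 2 ^ 2} := by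
  obtain ⟨u, hu⟩ : ∃ u : Fin 3 → ℝ, ∀ i, u i = (p i).re := ⟨_, fun _ => rfl⟩
  obtain ⟨v, hv⟩ : ∃ v : Fin 3 → ℝ, ∀ i, v i = (p i).im := ⟨_, fun _ => rfl⟩
  have hpuv : ∀ i, p i = u i + v i * Complex.I := fun i => by simp [hu, hv]
  obtain ⟨N, hN⟩ : ∃ N, N = u 0 ^ 2 + u 1 ^ 2 + u 2 ^ 2 := ⟨_, rfl⟩
  have hNv : N = v 0 ^ 2 + v 1 ^ 2 + v 2 ^ 2 := by
    have := congrArg Complex.re hq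
    simp [sq, ← hu, ← hv] at this
    linarith
  have huv : u 0 * v 0 + u 1 * v 1 + u 2 * v 2 = 0 := by
    have := congrArg Complex.im hq
    simp [sq, ← hu, ← hv] at this
    linarith
  have hN0 : N ≠ 0 := by
    intro h0
    apply hp
    have hu0 : ∀ i, u i = 0 := by
      intro i
      fin_cases i <;> simp <;> nlinarith [sq_nonneg (u 0), sq_nonneg (u 1), sq_nonneg (u 2)]
    have hv0 : ∀ i, v i = 0 := by
      intro i
      fin_cases i <;> simp <;> nlinarith [sq_nonneg (v 0), sq_nonneg (v 1), sq_nonneg (v 2)]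
    funext i
    simp [hpuv, hu0, hv0]
  obtain ⟨w, hw⟩ : ∃ w : Fin 3 → ℝ, w = ![u 1 * v 2 - u 2 * v 1,
    u 2 * v 0 - u 0 * v 2, u 0 * v 1 - u 1 * v 0] := ⟨_, rfl⟩
  let form (a : Fin 3 → ℝ) : MvPolynomial (Fin 3) ℝ := ∑ i, C (a i) * X i
  have form_homogeneous (a : Fin 3 → ℝ) : (form a).IsHomogeneous 1 :=
    IsHomogeneous.sum _ _ _ fun i _ => isHomogeneous_C_mul_X _ _
  have aeval_form (a : Fin 3 → ℝ) (x : Fin 3 → ℂ) : aeval x (form a) = ∑ i, (a i : ℂ) * x i := by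
    simp [form]
  refine ⟨form w, form_homogeneous w, fun P hP => ?_⟩
  set I := Ideal.span {form w, X (0 : Fin 3) ^ 2 + X 1 ^ 2 + X 2 ^ 2}
  have hW : form w ∈ I := Ideal.subset_span (by simp)
  have hQ : X (0 : Fin 3) ^ 2 + X 1 ^ 2 + X 2 ^ 2 ∈ I := Ideal.subset_span (by simp)
  have hrows : ∀ i j, N * u i * u j + N * v i * v j + w i * w j = if i = j then N ^ 2 else 0 := by
    intro i j
    fin_cases i <;> fin_cases j <;> simp [hw] <;> grind
  have hX (i : Fin 3) : (X i : MvPolynomial (Fin 3) ℝ) =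
      C (u i / N) * form u + C (v i / N) * form v + C (w i / N ^ 2) * form w := by
    simp only [form, Finset.mul_sum, ← Finset.sum_add_distrib, ← mul_assoc, ← add_mul, ← C_mul,
      ← C_add]
    have (j : Fin 3) : u i / N * u j + v i / N * v j + w i / N ^ 2 * w j =
        if i = j then 1 else 0 := by
      have := hrows i j
      split_ifs at this ⊢ <;> field_simp <;> linarith
    simp [this]
  have hsq : form u ^ 2 + form v ^ 2 ∈ I := by
    have hNX (i : Fin 3) : C N * X i =
        C (u i) * form u + C (v i) * form v + C N⁻¹ * C (w i) * form w := by
      nth_rw 1 [hX i]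
      simp only [mul_add, ← mul_assoc, ← C_mul]
      rw [show N * (u i / N) = u i by field_simp, show N * (v i / N) = v i by field_simp,
        show N * (w i / N ^ 2) = N⁻¹ * w i by field_simp]
    have hsum : form u ^ 2 + form v ^ 2 =
        C N * (X 0 ^ 2 + X 1 ^ 2 + X 2 ^ 2) - C N⁻¹ * form w * form w := by
      have form_eq (a : Fin 3 → ℝ) : form a = C (a 0) * X 0 + C (a 1) * X 1 + C (a 2) * X 2 :=
        Fin.sum_univ_three _
      linear_combination -X 0 * hNX 0 - X 1 * hNX 1 - X 2 * hNX 2 + form u * form_eq u +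
        form v * form_eq v + C N⁻¹ * form w * form_eq w
    rw [hsum]
    exact I.sub_mem (I.mul_mem_left _ hQ) (I.mul_mem_left _ hW)
  have rep (P : MvPolynomial (Fin 3) ℝ) : ∃ a b : Polynomial ℝ,
      P - (Polynomial.aeval (form v) a + form u * Polynomial.aeval (form v) b) ∈ I := by
    induction P using MvPolynomial.induction_on with
    | C r => exact ⟨.C r, 0, by simp [algebraMap_eq]⟩
    | add P Q hP hQ =>
      obtain ⟨a, b, h⟩ := hP
      obtain ⟨a', b', h'⟩ := hQ
      refine ⟨a + a', b + b', ?_⟩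
      convert I.add_mem h h' using 1
      simp only [map_add]
      ring
    | mul_X P i hP =>
      obtain ⟨a, b, h⟩ := hP
      refine ⟨.C (v i / N) * .X * a - .C (u i / N) * .X ^ 2 * b,
        .C (u i / N) * a + .C (v i / N) * .X * b, ?_⟩
      have h₁ := I.mul_mem_right (X i) h
      have h₂ := I.mul_mem_left
        (C (w i / N ^ 2) * (Polynomial.aeval (form v) a + form u * Polynomial.aeval (form v) b)) hW
      have h₃ := I.mul_mem_left (C (u i / N) * Polynomial.aeval (form v) b) hsq
      convert I.add_mem (I.add_mem h₁ h₂) h₃ using 1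
      simp only [map_add, map_sub, map_mul, map_pow, Polynomial.aeval_C, Polynomial.aeval_X,
        algebraMap_eq]
      linear_combination (Polynomial.aeval (form v) a +
        form u * Polynomial.aeval (form v) b) * hX i
  obtain ⟨a, b, hab⟩ := rep P
  have vanish (c : ℂ) : ∀ Q ∈ I, aeval (fun i => c * p i) Q = 0 := by
    intro Q hQ
    obtain ⟨A, B, rfl⟩ := Ideal.mem_span_pair.mp hQ
    have h₁ : aeval (fun i => c * p i) (form w) = 0 := by
      rw [aeval_form]
      simp [Fin.sum_univ_three, hw, hpuv]
      ring
    have h₂ : aeval (fun i => c * p i) (X (0 : Fin 3) ^ 2 + X 1 ^ 2 + X 2 ^ 2 :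
        MvPolynomial (Fin 3) ℝ) = 0 := by
      simp
      linear_combination c ^ 2 * hq
    rw [map_add, map_mul, map_mul, h₁, h₂]
    simp
  have hNC : (N : ℂ) ≠ 0 := by exact_mod_cast hN0
  have hNu : (N : ℂ) = u 0 ^ 2 + u 1 ^ 2 + u 2 ^ 2 := by exact_mod_cast hN
  have hNvC : (N : ℂ) = v 0 ^ 2 + v 1 ^ 2 + v 2 ^ 2 := by exact_mod_cast hNv
  have huvC : (u 0 * v 0 + u 1 * v 1 + u 2 * v 2 : ℂ) = 0 := by exact_mod_cast huv
  have key (s : ℝ) : ((a.eval s : ℝ) : ℂ) - Complex.I * s * ((b.eval s : ℝ) : ℂ) = 0 := by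
    have h := vanish (-Complex.I * s / N) _ hab
    have hv' : aeval (fun i => -Complex.I * s / N * p i) (form v) = algebraMap ℝ ℂ s := by
      rw [aeval_form]
      simp only [Fin.sum_univ_three, hpuv, Complex.coe_algebraMap]
      field_simp
      linear_combination (-Complex.I * s) * huvC - s * hNvC -
        s * (v 0 ^ 2 + v 1 ^ 2 + v 2 ^ 2) * Complex.I_sq
    have hu' : aeval (fun i => -Complex.I * s / N * p i) (form u) = -Complex.I * s := by
      rw [aeval_form]
      simp only [Fin.sum_univ_three, hpuv]
      field_simp
      linear_combination (-s * Complex.I) * huvC + s * hNu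
    rw [map_sub, hP, map_add, map_mul, ← Polynomial.aeval_algHom_apply,
      ← Polynomial.aeval_algHom_apply, hu', hv', Polynomial.aeval_algebraMap_apply,
      Polynomial.aeval_algebraMap_apply] at h
    simp at h
    linear_combination -h
  have ha : a = 0 := Polynomial.funext fun s => by
    simpa using congrArg Complex.re (key s)
  have hb : b = 0 := by
    have : Polynomial.X * b = 0 := Polynomial.funext fun s => by
      simpa using congrArg Complex.im (key s)
    simpa using this
  simpa [ha, hb] using hab

theorem isHomogeneous_sum_sq :
    (X (0 : Fin 3) ^ 2 + X 1 ^ 2 + X 2 ^ 2 : MvPolynomial (Fin 3) ℝ).IsHomogeneous 2 :=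
  ((isHomogeneous_X_pow _ _).add (isHomogeneous_X_pow _ _)).add (isHomogeneous_X_pow _ _)

/-- A real ternary form is, modulo `x² + y² + z²`, the product of a linear form and a form of
degree one less. -/
theorem exists_eq_linear_mul_add {d : ℕ} {P : MvPolynomial (Fin 3) ℝ}
    (hP : P.IsHomogeneous (d + 1)) :
    ∃ W Q R : MvPolynomial (Fin 3) ℝ, W.IsHomogeneous 1 ∧ Q.IsHomogeneous d ∧
      P = W * Q + (X (0 : Fin 3) ^ 2 + X 1 ^ 2 + X 2 ^ 2) * R := by
  obtain ⟨p, hp, hq, hPp⟩ := exists_aeval_eq_zero_on_conic d.succ_ne_zero hP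
  obtain ⟨W, hW, h⟩ := exists_linear_mem_span_of_aeval_eq_zero hp hq
  obtain ⟨Q, R, hQR⟩ := Ideal.mem_span_pair.mp
    (h P fun c => by rw [hP.aeval_mul_left, hPp, mul_zero])
  rcases d with _ | d
  · refine ⟨P, 1, 0, hP, isHomogeneous_one _ _, by simp⟩
  refine ⟨W, homogeneousComponent (d + 1) Q, homogeneousComponent d R, hW,
    homogeneousComponent_isHomogeneous _ _, ?_⟩
  have := congrArg (homogeneousComponent (d + 1 + 1)) hQR
  rw [mul_comm Q, mul_comm R, map_add, homogeneousComponent_eq_self hP,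
    hW.homogeneousComponent_mul (by omega),
    isHomogeneous_sum_sq.homogeneousComponent_mul (by omega)] at this
  exact this.symm

theorem exists_eq_prod_linear_add {d : ℕ} (hd : 1 ≤ d) :
    ∀ P : MvPolynomial (Fin 3) ℝ, P.IsHomogeneous d →
      ∃ (L : Fin d → MvPolynomial (Fin 3) ℝ) (R : MvPolynomial (Fin 3) ℝ),
        (∀ i, (L i).IsHomogeneous 1) ∧
        P = (∏ i, L i) + (X (0 : Fin 3) ^ 2 + X 1 ^ 2 + X 2 ^ 2) * R := by
  induction d, hd using Nat.le_induction with
  | base => exact fun P hP => ⟨fun _ => P, 0, fun _ => hP, by simp⟩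
  | succ d _ ih =>
    intro P hP
    obtain ⟨W, Q, R, hW, hQ, rfl⟩ := exists_eq_linear_mul_add hP
    obtain ⟨L, S, hL, rfl⟩ := ih Q hQ
    refine ⟨Fin.cons W L, W * S + R, Fin.cases (by simpa) (by simpa), ?_⟩
    rw [Fin.prod_univ_succ]
    simp only [Fin.cons_zero, Fin.cons_succ]
    ring

/-- Sylvester's theorem (existence part): every real homogeneous polynomial `P` of
degree `d` in `x, y, z` can be written as a product of `d` linear forms plus
`(x² + y² + z²)` times a homogeneous polynomial of degree `d - 2`. -/
theorem sylvester_decomposition (d : ℕ) (hd : 2 ≤ d)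
    (P : MvPolynomial (Fin 3) ℝ) (hP : P.IsHomogeneous d) :
    ∃ (L : Fin d → MvPolynomial (Fin 3) ℝ) (R : MvPolynomial (Fin 3) ℝ),
      (∀ i, (L i).IsHomogeneous 1) ∧ R.IsHomogeneous (d - 2) ∧
      P = (∏ i, L i) +
        (X (0 : Fin 3) ^ 2 + X 1 ^ 2 + X 2 ^ 2) * R := by
  obtain ⟨L, R, hL, h⟩ := exists_eq_prod_linear_add (by omega) P hP
  refine ⟨L, homogeneousComponent (d - 2) R, hL, homogeneousComponent_isHomogeneous _ _, ?_⟩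
  have hprod : (∏ i, L i).IsHomogeneous d := by
    simpa using IsHomogeneous.prod Finset.univ L (fun _ => 1) fun i _ => hL i
  have := congrArg (homogeneousComponent d) h
  rwa [map_add, homogeneousComponent_eq_self hP, homogeneousComponent_eq_self hprod,
    isHomogeneous_sum_sq.homogeneousComponent_mul hd] at this
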